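/- Let M ≥ 2 be an integer and let f : ℝ^{2M} → ℝ be a function such that for every Lagrangian subspace L of ℝ^{2M}, the restriction of f to L is ℝ-linear (i.e., f(x + y) = f(x) + f(y) and f(αx) = α f(x) for all x, y ∈ L and α ∈ ℝ). Then f is ℝ-linear on all of ℝ^{2M}, i.e., f belongs to the dual space (ℝ^{2M})*. -/

import Mathlib

open Module

noncomputable section

/-- The standard symplectic form on `ℝ^M × ℝ^M`:
`Ω((q,p),(q',p')) = q·p' − p·q'`. -/
def symp (M : ℕ) (x y : (Fin M → ℝ) × (Fin M → ℝ)) : ℝ :=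
  (∑ i, x.1 i * y.2 i) - ∑ i, x.2 i * y.1 i

open LinearMap (BilinForm)

section AlternatingForm

variable {K V : Type*} [Field K] [AddCommGroup V] [Module K V] {B : BilinForm K V}

/-- Adjoining a vector orthogonal to an isotropic subspace keeps it isotropic. -/
theorem isotropic_sup_span_singleton (hB : B.IsAlt) {W : Submodule K V}
    (hW : W ≤ B.orthogonal W) {z : V} (hz : z ∈ B.orthogonal W) :
    W ⊔ K ∙ z ≤ B.orthogonal (W ⊔ K ∙ z) := by
  intro b hb a ha
  obtain ⟨w, hw, c, hc, rfl⟩ := Submodule.mem_sup.1 ha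
  obtain ⟨w', hw', c', hc', rfl⟩ := Submodule.mem_sup.1 hb
  obtain ⟨s, rfl⟩ := Submodule.mem_span_singleton.1 hc
  obtain ⟨t, rfl⟩ := Submodule.mem_span_singleton.1 hc'
  have hww : B w w' = 0 := hW hw' w hw
  have hwz : B w z = 0 := hz w hw
  have hzw : B z w' = 0 := hB.isRefl _ _ (hz w' hw')
  simp [hww, hwz, hzw, hB z]

/-- An isotropic subspace is contained in a subspace equal to its own orthogonal complement. -/
theorem exists_le_eq_orthogonal [FiniteDimensional K V] (hB : B.IsAlt) {U : Submodule K V}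
    (hU : U ≤ B.orthogonal U) : ∃ W, U ≤ W ∧ W = B.orthogonal W := by
  obtain ⟨W, ⟨hUW, hW⟩, hmax⟩ := (wellFounded_gt (α := Submodule K V)).has_min
    {W | U ≤ W ∧ W ≤ B.orthogonal W} ⟨U, le_rfl, hU⟩
  refine ⟨W, hUW, le_antisymm hW fun z hz => ?_⟩
  by_contra hzW
  refine hmax (W ⊔ K ∙ z) ⟨hUW.trans le_sup_left, isotropic_sup_span_singleton hB hW hz⟩ ?_
  refine lt_of_le_of_ne le_sup_left fun h => hzW ?_
  rw [h]
  exact Submodule.mem_sup_right (Submodule.mem_span_singleton_self z)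

/-- Two orthogonal vectors lie in a common Lagrangian subspace. -/
theorem exists_lagrangian_of_ortho [FiniteDimensional K V] (hB : B.IsAlt)
    (hN : B.Nondegenerate) {x y : V} (hxy : B x y = 0) :
    ∃ W : Submodule K V, x ∈ W ∧ y ∈ W ∧ W ≤ B.orthogonal W ∧
      2 * finrank K W = finrank K V := by
  have hbot : (⊥ : Submodule K V) ≤ B.orthogonal ⊥ := bot_le
  have hx : (⊥ ⊔ K ∙ x : Submodule K V) ≤ B.orthogonal (⊥ ⊔ K ∙ x) :=
    isotropic_sup_span_singleton hB hbot (by simp)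
  rw [bot_sup_eq] at hx
  have hy : y ∈ B.orthogonal (K ∙ x) := by
    intro a ha
    obtain ⟨s, rfl⟩ := Submodule.mem_span_singleton.1 ha
    simp [hxy]
  obtain ⟨W, hle, hW⟩ := exists_le_eq_orthogonal hB (isotropic_sup_span_singleton hB hx hy)
  refine ⟨W, hle (Submodule.mem_sup_left (Submodule.mem_span_singleton_self x)),
    hle (Submodule.mem_sup_right (Submodule.mem_span_singleton_self y)), hW.le, ?_⟩
  have h := LinearMap.BilinForm.finrank_orthogonal hN W
  rw [← hW] at h
  have := Submodule.finrank_le W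
  omega

/-- In dimension greater than two, the orthogonal complement of a hyperbolic pair contains a pair
on which the form takes any prescribed value. -/
theorem exists_ortho_pair_apply_eq (hB : B.IsAlt) (hN : B.Nondegenerate)
    (hV : 2 < finrank K V) {x y : V} (hxy : B x y ≠ 0) (c : K) :
    ∃ u v, B x u = 0 ∧ B x v = 0 ∧ B y u = 0 ∧ B y v = 0 ∧ B u v = c := by
  classical
  have hyx : B y x = -B x y := (hB.neg_eq x y).symm
  let P : V → V := fun z => z - (B x z / B x y) • y + (B y z / B x y) • x
  have hxP : ∀ z, B x (P z) = 0 := fun z => by simp [P, hB x, hxy]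
  have hyP : ∀ z, B y (P z) = 0 := fun z => by simp [P, hB y, hyx, hxy]
  obtain ⟨z, w, hzw⟩ : ∃ z w, B (P z) (P w) ≠ 0 := by
    by_contra! h
    have hP : ∀ z, P z = 0 := fun z => hN.1 _ fun w => by
      have hPx : B (P z) x = 0 := hB.isRefl _ _ (hxP z)
      have hPy : B (P z) y = 0 := hB.isRefl _ _ (hyP z)
      have hw : B (P z) (P w) = B (P z) w := by
        change B (P z) (w - (B x w / B x y) • y + (B y w / B x y) • x) = _
        simp [hPx, hPy]
      rw [← hw, h]
    have htop : Submodule.span K (({x, y} : Finset V) : Set V) = ⊤ := by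
      refine eq_top_iff.2 fun z _ => ?_
      have hz : z = (-(B y z / B x y)) • x + (B x z / B x y) • y := by
        rw [← sub_eq_zero, ← hP z]
        module
      rw [Finset.coe_pair, Submodule.mem_span_pair]
      exact ⟨_, _, hz.symm⟩
    have hle := finrank_span_finset_le_card (R := K) ({x, y} : Finset V)
    rw [Set.finrank, htop, finrank_top] at hle
    have := Finset.card_le_two (a := x) (b := y)
    omega
  refine ⟨(c / B (P z) (P w)) • P z, P w, ?_, hxP w, ?_, hyP w, ?_⟩
  · simp [hxP]
  · simp [hyP]
  · simp [hzw]

/-- A homogeneous function that is additive on orthogonal pairs is additive, as soon as the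
space has dimension greater than two. -/
theorem map_add_of_map_add_of_ortho (hB : B.IsAlt) (hN : B.Nondegenerate)
    (hV : 2 < finrank K V) {f : V → K}
    (hadd : ∀ x y, B x y = 0 → f (x + y) = f x + f y)
    (hsmul : ∀ (a : K) x, f (a • x) = a * f x) [NeZero (2 : K)] (x y : V) :
    f (x + y) = f x + f y := by
  by_cases hxy : B x y = 0
  · exact hadd x y hxy
  obtain ⟨u, v, hxu, hxv, hyu, hyv, huv⟩ :=
    exists_ortho_pair_apply_eq hB hN hV hxy (-B x y)
  have huy : B u y = 0 := hB.isRefl _ _ hyu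
  have hneg : ∀ z, f (-z) = -f z := fun z => by simpa using hsmul (-1) z
  have hplus : f (x + y) + f (u + v) = f x + f u + (f y + f v) := by
    rw [← hadd x u hxu, ← hadd y v hyv, ← hadd (x + y) (u + v) (by simp [*]),
      ← hadd (x + u) (y + v) (by simp [*]), add_add_add_comm]
  have hminus : f (x + y) - f (u + v) = f x - f u + (f y - f v) := by
    simp only [sub_eq_add_neg, ← hneg]
    rw [← hadd x (-u) (by simp [*]), ← hadd y (-v) (by simp [*]),
      ← hadd (x + y) (-(u + v)) (by simp [*]), ← hadd (x + -u) (y + -v) (by simp [*]), neg_add,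
      add_add_add_comm]
  exact mul_left_cancel₀ (NeZero.ne (2 : K)) (by linear_combination hplus + hminus)

end AlternatingForm

/-- The standard symplectic form as a bilinear form. -/
def sympForm (M : ℕ) : BilinForm ℝ ((Fin M → ℝ) × (Fin M → ℝ)) :=
  LinearMap.mk₂ ℝ (symp M)
    (fun x y z => by simp [symp, add_mul, Finset.sum_add_distrib]; ring)
    (fun a x y => by simp [symp, mul_assoc, ← Finset.mul_sum, mul_sub])
    (fun x y z => by simp [symp, mul_add, Finset.sum_add_distrib]; ring)
    (fun a x y => by simp [symp, mul_left_comm _ a, ← Finset.mul_sum, mul_sub])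

theorem sympForm_apply (M : ℕ) (x y : (Fin M → ℝ) × (Fin M → ℝ)) :
    sympForm M x y = symp M x y := rfl

theorem sympForm_isAlt (M : ℕ) : (sympForm M).IsAlt := fun x => by
  simp [sympForm_apply, symp, mul_comm]

theorem sympForm_nondegenerate (M : ℕ) : (sympForm M).Nondegenerate := by
  have hleft : (sympForm M).SeparatingLeft := fun x hx => by
    ext i
    · simpa [sympForm_apply, symp, Pi.single_apply] using hx (0, Pi.single i 1)
    · simpa [sympForm_apply, symp, Pi.single_apply] using hx (Pi.single i 1, 0)
  exact ⟨hleft, fun y hy => hleft y fun x => (sympForm_isAlt M).isRefl _ _ (hy x)⟩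

/-- A function on phase space `ℝ^{2M}` (with `M ≥ 2`) which is `ℝ`-linear on every
Lagrangian subspace is globally `ℝ`-linear, i.e. an element of the dual space. -/
theorem linear_on_lagrangians_implies_linear
    (M : ℕ) (hM : 2 ≤ M) (f : (Fin M → ℝ) × (Fin M → ℝ) → ℝ)
    (hf : ∀ L : Submodule ℝ ((Fin M → ℝ) × (Fin M → ℝ)),
      Module.finrank ℝ L = M →
      (∀ x ∈ L, ∀ y ∈ L, symp M x y = 0) →
      ((∀ x ∈ L, ∀ y ∈ L, f (x + y) = f x + f y) ∧
       (∀ x ∈ L, ∀ α : ℝ, f (α • x) = α * f x))) :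
    IsLinearMap ℝ f := by
  have hdim : finrank ℝ ((Fin M → ℝ) × (Fin M → ℝ)) = 2 * M := by simp [two_mul]
  have hlag : ∀ x y, sympForm M x y = 0 →
      f (x + y) = f x + f y ∧ ∀ a : ℝ, f (a • x) = a * f x := fun x y hxy => by
    obtain ⟨L, hx, hy, hiso, hrank⟩ :=
      exists_lagrangian_of_ortho (sympForm_isAlt M) (sympForm_nondegenerate M) hxy
    obtain ⟨hadd, hsmul⟩ := hf L (by omega) fun a ha b hb => hiso hb a ha
    exact ⟨hadd x hx y hy, hsmul x hx⟩
  have hsmul : ∀ (a : ℝ) x, f (a • x) = a * f x := fun a x =>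
    (hlag x x (sympForm_isAlt M x)).2 a
  exact ⟨map_add_of_map_add_of_ortho (sympForm_isAlt M) (sympForm_nondegenerate M) (by omega)
    (fun x y hxy => (hlag x y hxy).1) hsmul, hsmul⟩
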